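/- The total weight of any set of cycles that can be subtracted from an obligation network is bounded by the weight of the maximum-weight balanced payment subsystem: if L is an n×n real matrix with nonnegative entries and zero diagonal, C₁, …, C_q are cycle matrices (each C_t assigns a constant weight p_t ≥ 0 to the edges of a cycle given by an injective map v_t : ZMod k_t → Fin n with k_t ≥ 2, and 0 elsewhere) such that ∑ t, C_t i j ≤ L i j for all i, j, and M ∈ S is any Grandsum-minimal feasible flow for L, then ∑ t, μ(C_t) ≤ μ(L) − μ(M), where μ is the sum of all matrix entries and S = {M | ∀ i j, 0 ≤ M i j ≤ L i j, and ∀ i, (∑ j, M i j) − (∑ j, M j i) = (∑ j, L i j) − (∑ j, L j i)}. -/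

import Mathlib

/- The cycle matrix of a cycle of length `k` given by `v : ZMod k → Fin n`, with
common edge weight `p`: entry `p` at each position `(v a, v (a+1))`, `0` elsewhere. -/
open Classical in
noncomputable def cycleMatrix (n k : ℕ) (v : ZMod k → Fin n) (p : ℝ) :
    Matrix (Fin n) (Fin n) ℝ :=
  fun i j => if ∃ a : ZMod k, i = v a ∧ j = v (a + 1) then p else 0

/-- The Grandsum of a matrix: the sum of all its entries. -/
noncomputable def grandsum {n : ℕ} (M : Matrix (Fin n) (Fin n) ℝ) : ℝ :=
  ∑ i, ∑ j, M i j

theorem cycleMatrix_nonneg {n k : ℕ} (v : ZMod k → Fin n) {p : ℝ} (hp : 0 ≤ p)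
    (i j : Fin n) : 0 ≤ cycleMatrix n k v p i j := by
  unfold cycleMatrix
  split_ifs
  · exact hp
  · exact le_rfl

open Classical in
theorem cycleMatrix_row_sum {n k : ℕ} {v : ZMod k → Fin n} (hv : Function.Injective v)
    (p : ℝ) (i : Fin n) :
    ∑ j, cycleMatrix n k v p i j = if i ∈ Set.range v then p else 0 := by
  by_cases h : i ∈ Set.range v
  · obtain ⟨b, rfl⟩ := h
    have key (j : Fin n) : (∃ a, v b = v a ∧ j = v (a + 1)) ↔ j = v (b + 1) := by
      constructor
      · rintro ⟨a, ha, rfl⟩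
        rw [hv ha]
      · rintro rfl
        exact ⟨b, rfl, rfl⟩
    simp [cycleMatrix, key]
  · rw [if_neg h]
    refine Finset.sum_eq_zero fun j _ => if_neg ?_
    rintro ⟨a, rfl, -⟩
    exact h ⟨a, rfl⟩

open Classical in
theorem cycleMatrix_col_sum {n k : ℕ} {v : ZMod k → Fin n} (hv : Function.Injective v)
    (p : ℝ) (j : Fin n) :
    ∑ i, cycleMatrix n k v p i j = if j ∈ Set.range v then p else 0 := by
  by_cases h : j ∈ Set.range v
  · obtain ⟨b, rfl⟩ := h
    have key (i : Fin n) : (∃ a, i = v a ∧ v b = v (a + 1)) ↔ i = v (b - 1) := by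
      constructor
      · rintro ⟨a, rfl, ha⟩
        rw [hv ha, add_sub_cancel_right]
      · rintro rfl
        exact ⟨b - 1, rfl, by rw [sub_add_cancel]⟩
    simp [cycleMatrix, key]
  · rw [if_neg h]
    refine Finset.sum_eq_zero fun i _ => if_neg ?_
    rintro ⟨a, -, rfl⟩
    exact h ⟨a + 1, rfl⟩

theorem cycleMatrix_row_sum_eq_col_sum {n k : ℕ} {v : ZMod k → Fin n}
    (hv : Function.Injective v) (p : ℝ) (i : Fin n) :
    ∑ j, cycleMatrix n k v p i j = ∑ j, cycleMatrix n k v p j i := by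
  rw [cycleMatrix_row_sum hv, cycleMatrix_col_sum hv]

/-- The total weight of any set of cycles that can be subtracted
from an obligation network is bounded by the weight of the maximum-weight
balanced payment subsystem: if the cycle matrices `C t` sum entrywise to at most
`L`, and `M` is a Grandsum-minimal feasible flow for `L`, then
`∑ t, μ(C t) ≤ μ(L) − μ(M)`. -/
theorem cycles_weight_le_max_balanced_weight {n q : ℕ}
    (L : Matrix (Fin n) (Fin n) ℝ)
    (hL : ∀ i j, 0 ≤ L i j) (hLdiag : ∀ i, L i i = 0)
    (k : Fin q → ℕ) (hk : ∀ t, 2 ≤ k t)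
    (v : (t : Fin q) → ZMod (k t) → Fin n) (hv : ∀ t, Function.Injective (v t))
    (p : Fin q → ℝ) (hp : ∀ t, 0 ≤ p t)
    (hle : ∀ i j, ∑ t, cycleMatrix n (k t) (v t) (p t) i j ≤ L i j)
    (S : Set (Matrix (Fin n) (Fin n) ℝ))
    (hS : S = {M | (∀ i j, 0 ≤ M i j ∧ M i j ≤ L i j) ∧
      ∀ i, (∑ j, M i j) - (∑ j, M j i) = (∑ j, L i j) - (∑ j, L j i)})
    (M : Matrix (Fin n) (Fin n) ℝ) (hM : M ∈ S)
    (hmin : ∀ M' ∈ S, grandsum M ≤ grandsum M') :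
    ∑ t, grandsum (cycleMatrix n (k t) (v t) (p t)) ≤ grandsum L - grandsum M := by
  have hbal (i : Fin n) : ∑ j, ∑ t, cycleMatrix n (k t) (v t) (p t) i j =
      ∑ j, ∑ t, cycleMatrix n (k t) (v t) (p t) j i := by
    rw [Finset.sum_comm, Finset.sum_comm (f := fun j t => cycleMatrix n (k t) (v t) (p t) j i)]
    exact Finset.sum_congr rfl fun t _ => cycleMatrix_row_sum_eq_col_sum (hv t) (p t) i
  have hsum : ∑ t, grandsum (cycleMatrix n (k t) (v t) (p t)) =
      ∑ i, ∑ j, ∑ t, cycleMatrix n (k t) (v t) (p t) i j := by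
    unfold grandsum
    rw [Finset.sum_comm]
    exact Finset.sum_congr rfl fun i _ => Finset.sum_comm
  have hmem : (fun i j => L i j - ∑ t, cycleMatrix n (k t) (v t) (p t) i j) ∈ S := by
    rw [hS]
    refine ⟨fun i j => ⟨sub_nonneg.2 (hle i j), sub_le_self _ ?_⟩, fun i => ?_⟩
    · exact Finset.sum_nonneg fun t _ => cycleMatrix_nonneg (v t) (hp t) i j
    · simp only [Finset.sum_sub_distrib]
      rw [hbal i]
      ring
  have hM' := hmin _ hmem
  rw [hsum]
  simp only [grandsum, Finset.sum_sub_distrib] at hM' ⊢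
  linarith
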